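/- arXiv:math/0610242 — 2 statements merged into one kernel-verified Lean document; each statement's English description precedes it below -/
import Mathlib

section
/- Under hypotheses (H0)-(H4), the Markov chain (Z(t)) on ℤ^{d−1}×ℕ is transient, i.e. its Green's function G(z,z') = Σ_{t≥0} P_z(Z(t)=z') is finite for all z,z' ∈ ℤ^{d−1}×ℕ. -/
open scoped ENNReal
open Filter MeasureTheory

namespace ReflectedRW

/-- `ℤ^d` realized as `ℤ^{d-1} × ℤ`. -/
abbrev Zd (d : ℕ) := (Fin (d-1) → ℤ) × ℤ
/-- `ℝ^d` realized as `ℝ^{d-1} × ℝ`. -/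
abbrev Rd (d : ℕ) := (Fin (d-1) → ℝ) × ℝ
/-- The state space `ℤ^{d-1} × ℕ` of the reflected walk. -/
abbrev St (d : ℕ) := (Fin (d-1) → ℤ) × ℕ

/-- Embedding of the state space into `ℤ^d`. -/
def toZ (d : ℕ) (z : St d) : Zd d := (z.1, (z.2 : ℤ))

/-- Embedding of `ℤ^d` into `ℝ^d`. -/
def toR (d : ℕ) (z : Zd d) : Rd d := (fun i => (z.1 i : ℝ), (z.2 : ℝ))

/-- Scalar product `a · z` of `a ∈ ℝ^d` and `z ∈ ℤ^d`. -/
noncomputable def dotZ (d : ℕ) (a : Rd d) (z : Zd d) : ℝ :=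
  (∑ i, a.1 i * (z.1 i : ℝ)) + a.2 * (z.2 : ℝ)

/-- Scalar product on `ℝ^d`. -/
noncomputable def dotR (d : ℕ) (a q : Rd d) : ℝ :=
  (∑ i, a.1 i * q.1 i) + a.2 * q.2

/-- One-step transition probabilities of the reflected random walk `Z(t)`:
jumps with law `μ` in the interior and with law `μ0` on the boundary `y = 0`. -/
noncomputable def step (d : ℕ) (μ μ0 : Zd d → ℝ) (z z' : St d) : ℝ≥0∞ :=
  if z.2 = 0 then ENNReal.ofReal (μ0 (toZ d z' - toZ d z))
  else ENNReal.ofReal (μ (toZ d z' - toZ d z))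

/-- Real-valued version of the transition kernel of `Z(t)`. -/
noncomputable def stepR (d : ℕ) (μ μ0 : Zd d → ℝ) (z z' : St d) : ℝ :=
  if z.2 = 0 then μ0 (toZ d z' - toZ d z) else μ (toZ d z' - toZ d z)

/-- `n`-step kernel obtained by iterating a sub-Markov kernel `p`. -/
noncomputable def kerIter {S : Type*} [DecidableEq S] (p : S → S → ℝ≥0∞) :
    ℕ → S → S → ℝ≥0∞
  | 0, z, z' => if z = z' then 1 else 0
  | n+1, z, z' => ∑' w : S, kerIter p n z w * p w z'

/-- `n`-step transition probabilities of `Z(t)`: `P_z(Z(n) = z')`. -/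
noncomputable def stepn (d : ℕ) (μ μ0 : Zd d → ℝ) : ℕ → St d → St d → ℝ≥0∞ :=
  kerIter (step d μ μ0)

/-- Green's function `G(z,z') = ∑_{t ≥ 0} P_z(Z(t) = z')` of the reflected walk. -/
noncomputable def green (d : ℕ) (μ μ0 : Zd d → ℝ) (z z' : St d) : ℝ≥0∞ :=
  ∑' n : ℕ, stepn d μ μ0 n z z'

/-- Kernel of the walk killed upon hitting the boundary hyperplane `y = 0`. -/
noncomputable def stepKilled (d : ℕ) (μ μ0 : Zd d → ℝ) (z z' : St d) : ℝ≥0∞ :=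
  if z'.2 = 0 then 0 else step d μ μ0 z z'

/-- `n`-step kernel of the killed walk: `P_z(Z(n) = z', τ > n)` where
`τ` is the first return time to the boundary hyperplane. -/
noncomputable def stepKilledn (d : ℕ) (μ μ0 : Zd d → ℝ) : ℕ → St d → St d → ℝ≥0∞ :=
  kerIter (stepKilled d μ μ0)

/-- Green's function `G₊(z,z')` of the killed walk. -/
noncomputable def greenPlus (d : ℕ) (μ μ0 : Zd d → ℝ) (z z' : St d) : ℝ≥0∞ :=
  ∑' n : ℕ, stepKilledn d μ μ0 n z z'

/-- One-step kernel of the homogeneous random walk `S(t)` on `ℤ^d`. -/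
noncomputable def stepS (d : ℕ) (μ : Zd d → ℝ) (z z' : Zd d) : ℝ≥0∞ :=
  ENNReal.ofReal (μ (z' - z))

/-- `n`-step kernel of the homogeneous random walk on `ℤ^d`. -/
noncomputable def stepSn (d : ℕ) (μ : Zd d → ℝ) : ℕ → Zd d → Zd d → ℝ≥0∞ :=
  kerIter (stepS d μ)

/-- Green's function `G_S` of the homogeneous random walk on `ℤ^d`. -/
noncomputable def greenS (d : ℕ) (μ : Zd d → ℝ) (z z' : Zd d) : ℝ≥0∞ :=
  ∑' n : ℕ, stepSn d μ n z z'

/-- `hitProb z w = P_z(τ < ∞, Z(τ) = w)`, the hitting distribution on the boundary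
hyperplane, `τ = inf{t ≥ 1 : Z(t) ∈ ℤ^{d-1}×{0}}`. -/
noncomputable def hitProb (d : ℕ) (μ μ0 : Zd d → ℝ) (z w : St d) : ℝ≥0∞ :=
  if w.2 = 0 then
    ∑' n : ℕ, ∑' v : St d, stepKilledn d μ μ0 n z v * step d μ μ0 v w
  else 0

/-- The jump generating function `φ(a) = ∑_z μ(z) e^{a·z}`. -/
noncomputable def jgf (d : ℕ) (μ : Zd d → ℝ) (a : Rd d) : ℝ :=
  ∑' z : Zd d, μ z * Real.exp (dotZ d a z)

/-- Partial derivative `∂φ/∂β` of the jump generating function in the last coordinate. -/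
noncomputable def jgfDβ (d : ℕ) (μ : Zd d → ℝ) (a : Rd d) : ℝ :=
  ∑' z : Zd d, μ z * (z.2 : ℝ) * Real.exp (dotZ d a z)

/-- Gradient `∇φ(a)` of the jump generating function. -/
noncomputable def jgfGrad (d : ℕ) (μ : Zd d → ℝ) (a : Rd d) : Rd d :=
  (fun i => ∑' z : Zd d, μ z * (z.1 i : ℝ) * Real.exp (dotZ d a z), jgfDβ d μ a)

/-- The set `D = {a : φ(a) ≤ 1}`. -/
def Dset (d : ℕ) (μ : Zd d → ℝ) : Set (Rd d) := {a | jgf d μ a ≤ 1}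

/-- `∂₊D`: points of the boundary of `D` where the last coordinate of `∇φ` is `≥ 0`. -/
def bdPlus (d : ℕ) (μ : Zd d → ℝ) : Set (Rd d) :=
  {a | jgf d μ a = 1 ∧ 0 ≤ jgfDβ d μ a}

/-- `∂₋D`: points of the boundary of `D` where the last coordinate of `∇φ` is `≤ 0`. -/
def bdMinus (d : ℕ) (μ : Zd d → ℝ) : Set (Rd d) :=
  {a | jgf d μ a = 1 ∧ jgfDβ d μ a ≤ 0}

/-- `∂₀D`: points of the boundary of `D` where the last coordinate of `∇φ` is `0`. -/
def bdZero (d : ℕ) (μ : Zd d → ℝ) : Set (Rd d) :=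
  {a | jgf d μ a = 1 ∧ jgfDβ d μ a = 0}

/-- `Θ = {α ∈ ℝ^{d-1} : inf_β max(φ(α,β), φ₀(α,β)) ≤ 1}`. -/
noncomputable def Theta (d : ℕ) (μ μ0 : Zd d → ℝ) : Set (Fin (d-1) → ℝ) :=
  {α | (⨅ β : ℝ, max (jgf d μ (α, β)) (jgf d μ0 (α, β))) ≤ 1}

/-- `D̂ = (Θ×ℝ) ∩ D`. -/
noncomputable def Dhat (d : ℕ) (μ μ0 : Zd d → ℝ) : Set (Rd d) :=
  {a | a.1 ∈ Theta d μ μ0 ∧ jgf d μ a ≤ 1}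

/-- Normal cone to a convex set `s ⊆ ℝ^d` at the point `a`. -/
noncomputable def normalCone (d : ℕ) (s : Set (Rd d)) (a : Rd d) : Set (Rd d) :=
  {q | ∀ b ∈ s, dotR d q (b - a) ≤ 0}

/-- The mean vector `m = ∑_z z μ(z)`. -/
noncomputable def meanVec (d : ℕ) (μ : Zd d → ℝ) : Rd d :=
  (fun i => ∑' z : Zd d, μ z * (z.1 i : ℝ), ∑' z : Zd d, μ z * (z.2 : ℝ))

/-- The harmonic functions `h_a` of (1-8), for `a ∈ D̂ ∩ ∂₊D` with associated
point `abar = ā ∈ ∂₋D` (same first `d-1` coordinates as `a`). -/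
noncomputable def hfun (d : ℕ) (μ μ0 : Zd d → ℝ) (a abar : Rd d) (z : St d) : ℝ :=
  if jgf d μ0 abar = 1 then Real.exp (dotZ d abar (toZ d z))
  else if a = abar then
    (z.2 : ℝ) * Real.exp (dotZ d a (toZ d z))
      + (jgfDβ d μ0 a / (1 - jgf d μ0 a)) * Real.exp (dotZ d a (toZ d z))
  else
    Real.exp (dotZ d a (toZ d z))
      - ((1 - jgf d μ0 a) / (1 - jgf d μ0 abar)) * Real.exp (dotZ d abar (toZ d z))

/-- `h : ℤ^{d-1}×ℕ → ℝ` is harmonic for the reflected walk. -/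
def IsHarmonic (d : ℕ) (μ μ0 : Zd d → ℝ) (h : St d → ℝ) : Prop :=
  ∀ z : St d, HasSum (fun z' => stepR d μ μ0 z z' * h z') (h z)

/-- Minimal nonnegative harmonic function. -/
def IsMinimalHarmonic (d : ℕ) (μ μ0 : Zd d → ℝ) (h : St d → ℝ) : Prop :=
  IsHarmonic d μ μ0 h ∧ (∀ z, 0 ≤ h z) ∧ h ≠ 0 ∧
    ∀ h' : St d → ℝ, IsHarmonic d μ μ0 h' → (∀ z, 0 ≤ h' z) → h' ≠ 0 →
      (∀ z, h' z ≤ h z) → ∃ c : ℝ, 0 < c ∧ h' = fun z => c * h z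

/- Hypotheses (H0)–(H4). -/

/-- `(H0)`: `μ(x,y) = 0` for `y < -1` and `μ₀(x,y) = 0` for `y < 0`. -/
def H0 (d : ℕ) (μ μ0 : Zd d → ℝ) : Prop :=
  (∀ z : Zd d, z.2 < -1 → μ z = 0) ∧ (∀ z : Zd d, z.2 < 0 → μ0 z = 0)

/-- `(H1)`: the reflected walk is irreducible on `ℤ^{d-1}×ℕ`. -/
def H1 (d : ℕ) (μ μ0 : Zd d → ℝ) : Prop :=
  ∀ z z' : St d, ∃ n : ℕ, 0 < stepn d μ μ0 n z z'

/-- `(H2)`: the homogeneous walk with step law `μ` is irreducible on `ℤ^d` and its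
last coordinate is an aperiodic random walk on `ℤ`. -/
def H2 (d : ℕ) (μ : Zd d → ℝ) : Prop :=
  (∀ z z' : Zd d, ∃ n : ℕ, 0 < stepSn d μ n z z') ∧
    AddSubgroup.closure {y : ℤ | ∃ x : Fin (d-1) → ℤ, μ (x, y) ≠ 0} = ⊤

/-- `(H3)`: `m ≠ 0` and `m/|m| + m₀/|m₀| ≠ 0`. -/
noncomputable def H3 (d : ℕ) (μ μ0 : Zd d → ℝ) : Prop :=
  meanVec d μ ≠ 0 ∧ meanVec d μ0 ≠ 0 ∧
    ‖meanVec d μ‖⁻¹ • meanVec d μ + ‖meanVec d μ0‖⁻¹ • meanVec d μ0 ≠ 0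

/-- `(H4)`: the jump generating functions are finite everywhere on `ℝ^d`. -/
def H4 (d : ℕ) (μ μ0 : Zd d → ℝ) : Prop :=
  ∀ a : Rd d, Summable (fun z : Zd d => μ z * Real.exp (dotZ d a z)) ∧
    Summable (fun z : Zd d => μ0 z * Real.exp (dotZ d a z))

/-- `μ` is a probability distribution on `ℤ^d`. -/
def IsProb (d : ℕ) (μ : Zd d → ℝ) : Prop :=
  (∀ z : Zd d, 0 ≤ μ z) ∧ HasSum μ 1


/-- A strictly contracted weight stays contracted along the iterates of the kernel. -/
theorem tsum_kerIter_mul_le {S : Type*} [DecidableEq S] {p : S → S → ℝ≥0∞} {h : S → ℝ≥0∞}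
    {θ : ℝ≥0∞} (hp : ∀ z, ∑' w, p z w * h w ≤ θ * h z) (n : ℕ) (z : S) :
    ∑' w, kerIter p n z w * h w ≤ θ ^ n * h z := by
  induction n with
  | zero =>
    rw [tsum_eq_single z fun w hw => by simp [kerIter, hw.symm]]
    simp [kerIter]
  | succ n ih =>
    calc ∑' w, kerIter p (n + 1) z w * h w
        = ∑' w, ∑' v, kerIter p n z v * (p v w * h w) := by
          simp only [kerIter, ← ENNReal.tsum_mul_right, mul_assoc]
      _ = ∑' v, kerIter p n z v * ∑' w, p v w * h w := by
          rw [ENNReal.tsum_comm]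
          simp only [ENNReal.tsum_mul_left]
      _ ≤ ∑' v, kerIter p n z v * (θ * h v) :=
          ENNReal.tsum_le_tsum fun v => mul_le_mul_right (hp v) _
      _ = θ * ∑' v, kerIter p n z v * h v := by
          rw [← ENNReal.tsum_mul_left]
          exact tsum_congr fun v => mul_left_comm _ _ _
      _ ≤ θ ^ (n + 1) * h z := by
          rw [pow_succ', mul_assoc]
          exact mul_le_mul_right ih _

/-- A kernel that strictly contracts a positive finite weight has a finite Green's function. -/
theorem tsum_kerIter_lt_top {S : Type*} [DecidableEq S] {p : S → S → ℝ≥0∞} {h : S → ℝ≥0∞}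
    {θ : ℝ≥0∞} (hp : ∀ z, ∑' w, p z w * h w ≤ θ * h z) (hθ : θ < 1)
    (h_pos : ∀ z, h z ≠ 0) (h_fin : ∀ z, h z ≠ ⊤) (z z' : S) :
    ∑' n, kerIter p n z z' < ⊤ := by
  have hle : (∑' n, kerIter p n z z') * h z' ≤ (1 - θ)⁻¹ * h z := by
    rw [← ENNReal.tsum_mul_right, ← ENNReal.tsum_geometric, ← ENNReal.tsum_mul_right]
    exact ENNReal.tsum_le_tsum fun n =>
      (ENNReal.le_tsum z').trans (tsum_kerIter_mul_le hp n z)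
  have hfin : (1 - θ)⁻¹ * h z < ⊤ :=
    ENNReal.mul_lt_top (ENNReal.inv_lt_top.2 (tsub_pos_of_lt hθ)) (h_fin z).lt_top
  by_contra htop
  rw [not_lt, top_le_iff] at htop
  rw [htop, ENNReal.top_mul (h_pos z')] at hle
  exact absurd hfin (not_lt.2 hle)

theorem dotZ_add (d : ℕ) (a : Rd d) (z w : Zd d) :
    dotZ d a (z + w) = dotZ d a z + dotZ d a w := by
  simp only [dotZ, Prod.fst_add, Prod.snd_add, Pi.add_apply, Int.cast_add, mul_add,
    Finset.sum_add_distrib]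
  ring

theorem dotZ_smul (d : ℕ) (t : ℝ) (a : Rd d) (z : Zd d) :
    dotZ d (t • a) z = t * dotZ d a z := by
  simp only [dotZ, Prod.smul_fst, Prod.smul_snd, Pi.smul_apply, smul_eq_mul, mul_add,
    Finset.mul_sum, mul_assoc]

theorem toZ_injective (d : ℕ) : Function.Injective (toZ d) := by
  rintro ⟨x, y⟩ ⟨x', y'⟩ h
  simpa [toZ] using h

/-- One step of a homogeneous walk multiplies the exponential weight by at most `φ(a)`. -/
theorem tsum_ofReal_mul_exp_le {d : ℕ} {ν : Zd d → ℝ} {a : Rd d} (hν : ∀ z, 0 ≤ ν z)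
    (hs : Summable fun z => ν z * Real.exp (dotZ d a z)) (z : St d) :
    ∑' w : St d, ENNReal.ofReal (ν (toZ d w - toZ d z)) *
        ENNReal.ofReal (Real.exp (dotZ d a (toZ d w)))
      ≤ ENNReal.ofReal (jgf d ν a) * ENNReal.ofReal (Real.exp (dotZ d a (toZ d z))) := by
  have hinj : Function.Injective fun w : St d => toZ d w - toZ d z :=
    fun w w' hw => toZ_injective d (sub_left_injective hw)
  have heq (w : St d) : ENNReal.ofReal (ν (toZ d w - toZ d z)) *
        ENNReal.ofReal (Real.exp (dotZ d a (toZ d w))) =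
      ENNReal.ofReal (ν (toZ d w - toZ d z) * Real.exp (dotZ d a (toZ d w - toZ d z))) *
        ENNReal.ofReal (Real.exp (dotZ d a (toZ d z))) := by
    rw [← ENNReal.ofReal_mul (hν _),
      ← ENNReal.ofReal_mul (mul_nonneg (hν _) (Real.exp_nonneg _)), mul_assoc, ← Real.exp_add,
      ← dotZ_add, sub_add_cancel]
  rw [tsum_congr heq, ENNReal.tsum_mul_right, jgf,
    ENNReal.ofReal_tsum_of_nonneg (fun w => mul_nonneg (hν w) (Real.exp_nonneg _)) hs]
  gcongr
  exact ENNReal.tsum_comp_le_tsum_of_injective hinj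
    fun w => ENNReal.ofReal (ν w * Real.exp (dotZ d a w))

theorem exp_abs_le_exp_add_exp_neg (x : ℝ) : Real.exp |x| ≤ Real.exp x + Real.exp (-x) := by
  rcases abs_cases x with ⟨h, _⟩ | ⟨h, _⟩ <;> rw [h] <;>
    linarith [Real.exp_pos x, Real.exp_pos (-x)]

theorem exp_mul_le_quadratic {t : ℝ} (ht0 : 0 ≤ t) (ht1 : t ≤ 1) (x : ℝ) :
    Real.exp (t * x) ≤ 1 + t * x + 2 * t ^ 2 * (Real.exp (2 * x) + Real.exp (-2 * x)) := by
  have htaylor : Real.exp (t * x) ≤ 1 + t * x + (t * x) ^ 2 * Real.exp |t * x| := by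
    have h := Complex.norm_exp_sub_sum_le_norm_mul_exp ((t * x : ℝ) : ℂ) 2
    simp only [Finset.sum_range_succ, Finset.sum_range_zero] at h
    norm_num at h
    have h' : ‖((Real.exp (t * x) - (1 + t * x) : ℝ) : ℂ)‖
        ≤ (|t| * |x|) ^ 2 * Real.exp (|t| * |x|) := by push_cast; exact h
    rw [Complex.norm_real, Real.norm_eq_abs, ← abs_mul, sq_abs] at h'
    linarith [le_abs_self (Real.exp (t * x) - (1 + t * x))]
  have habs : |t * x| ≤ |x| := by
    rw [abs_mul, abs_of_nonneg ht0]
    exact mul_le_of_le_one_left (abs_nonneg x) ht1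
  have hsq : x ^ 2 ≤ 2 * Real.exp |x| := by
    have := Real.quadratic_le_exp_of_nonneg (abs_nonneg x)
    rw [sq_abs] at this
    linarith [abs_nonneg x]
  have hexp : Real.exp |x| * Real.exp |x| ≤ Real.exp (2 * x) + Real.exp (-2 * x) := by
    have := exp_abs_le_exp_add_exp_neg (2 * x)
    rw [abs_mul, abs_two, two_mul |x|, Real.exp_add, ← neg_mul] at this
    exact this
  calc Real.exp (t * x) ≤ 1 + t * x + (t * x) ^ 2 * Real.exp |t * x| := htaylor
    _ ≤ 1 + t * x + t ^ 2 * (2 * Real.exp |x|) * Real.exp |x| := by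
        rw [mul_pow]
        gcongr
    _ = 1 + t * x + 2 * t ^ 2 * (Real.exp |x| * Real.exp |x|) := by ring
    _ ≤ _ := by gcongr

theorem summable_mul_dotZ {d : ℕ} {ν : Zd d → ℝ} (hν : ∀ z, 0 ≤ ν z)
    (hs : ∀ a, Summable fun z => ν z * Real.exp (dotZ d a z)) (a : Rd d) :
    Summable fun z => ν z * dotZ d a z := by
  refine Summable.of_norm_bounded ((hs a).add (hs ((-1 : ℝ) • a))) fun z => ?_
  rw [norm_mul, Real.norm_of_nonneg (hν z), Real.norm_eq_abs, ← mul_add, dotZ_smul, neg_one_mul]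
  refine mul_le_mul_of_nonneg_left ?_ (hν z)
  linarith [Real.add_one_le_exp |dotZ d a z|, exp_abs_le_exp_add_exp_neg (dotZ d a z)]

theorem tsum_mul_dotZ {d : ℕ} {ν : Zd d → ℝ} (hν : ∀ z, 0 ≤ ν z)
    (hs : ∀ a, Summable fun z => ν z * Real.exp (dotZ d a z)) (a : Rd d) :
    ∑' z, ν z * dotZ d a z = dotR d a (meanVec d ν) := by
  have h1 (i : Fin (d - 1)) : Summable fun z : Zd d => ν z * (z.1 i : ℝ) := by
    simpa [dotZ, Pi.single_apply] using summable_mul_dotZ hν hs (Pi.single i 1, 0)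
  have h2 : Summable fun z : Zd d => ν z * (z.2 : ℝ) := by
    simpa [dotZ] using summable_mul_dotZ hν hs (0, 1)
  have h := (hasSum_sum (s := Finset.univ) fun i _ => (h1 i).hasSum.mul_left (a.1 i)).add
    (h2.hasSum.mul_left a.2)
  rw [dotR, meanVec, ← h.tsum_eq]
  refine tsum_congr fun z => ?_
  rw [dotZ, mul_add, Finset.mul_sum]
  congr 1
  · exact Finset.sum_congr rfl fun i _ => mul_left_comm _ _ _
  · exact mul_left_comm _ _ _

/-- Quadratic upper bound for the jump generating function along a ray. -/
theorem jgf_smul_le {d : ℕ} {ν : Zd d → ℝ} (hν : IsProb d ν)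
    (hs : ∀ a, Summable fun z => ν z * Real.exp (dotZ d a z)) (a : Rd d)
    {t : ℝ} (ht0 : 0 ≤ t) (ht1 : t ≤ 1) :
    jgf d ν (t • a) ≤ 1 + t * dotR d a (meanVec d ν) +
      2 * t ^ 2 * (jgf d ν ((2 : ℝ) • a) + jgf d ν ((-2 : ℝ) • a)) := by
  have h := (hν.2.add ((summable_mul_dotZ hν.1 hs a).hasSum.mul_left t)).add
    (((hs ((2 : ℝ) • a)).hasSum.add (hs ((-2 : ℝ) • a)).hasSum).mul_left (2 * t ^ 2))
  rw [tsum_mul_dotZ hν.1 hs] at h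
  refine hasSum_le (fun z => ?_) (hs (t • a)).hasSum h
  simp only [dotZ_smul]
  have := mul_le_mul_of_nonneg_left (exp_mul_le_quadratic ht0 ht1 (dotZ d a z)) (hν.1 z)
  linarith

/-- Along a direction of negative drift the jump generating function is eventually below `1`. -/
theorem eventually_jgf_smul_lt_one {d : ℕ} {ν : Zd d → ℝ} (hν : IsProb d ν)
    (hs : ∀ a, Summable fun z => ν z * Real.exp (dotZ d a z)) {a : Rd d}
    (ha : dotR d a (meanVec d ν) < 0) : ∀ᶠ t in nhdsWithin (0 : ℝ) (Set.Ioi 0),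
      jgf d ν (t • a) < 1 := by
  set K := jgf d ν ((2 : ℝ) • a) + jgf d ν ((-2 : ℝ) • a)
  have hlim : Tendsto (fun t : ℝ => dotR d a (meanVec d ν) + 2 * t * K)
      (nhdsWithin 0 (Set.Ioi 0)) (nhds (dotR d a (meanVec d ν) + 2 * 0 * K)) :=
    (by fun_prop : Continuous fun t : ℝ => dotR d a (meanVec d ν) + 2 * t * K).continuousWithinAt
  filter_upwards [hlim.eventually_lt_const (by simpa using ha),
    Ioo_mem_nhdsGT (zero_lt_one' ℝ)] with t hneg ht
  have := jgf_smul_le hν hs a ht.1.le ht.2.le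
  nlinarith [mul_neg_of_pos_of_neg ht.1 hneg]

theorem dotR_self_nonneg (d : ℕ) (v : Rd d) : 0 ≤ dotR d v v :=
  add_nonneg (Finset.sum_nonneg fun _ _ => mul_self_nonneg _) (mul_self_nonneg _)

theorem dotR_self_eq_zero {d : ℕ} {v : Rd d} : dotR d v v = 0 ↔ v = 0 := by
  rw [dotR, add_eq_zero_iff_of_nonneg (Finset.sum_nonneg fun _ _ => mul_self_nonneg _)
    (mul_self_nonneg _), Finset.sum_eq_zero_iff_of_nonneg fun _ _ => mul_self_nonneg _]
  simp [Prod.ext_iff, funext_iff]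

theorem dotR_comm (d : ℕ) (a b : Rd d) : dotR d a b = dotR d b a := by
  simp only [dotR, mul_comm]

theorem dotR_smul_add_smul (d : ℕ) (r s : ℝ) (a b c : Rd d) :
    dotR d (r • a + s • b) c = r * dotR d a c + s * dotR d b c := by
  simp only [dotR, Prod.fst_add, Prod.snd_add, Prod.smul_fst, Prod.smul_snd, Pi.add_apply,
    Pi.smul_apply, smul_eq_mul, mul_add, add_mul, Finset.mul_sum, Finset.sum_add_distrib,
    mul_assoc]
  ring

/-- Two nonzero vectors that are not opposite lie in a common open half-space. -/
theorem exists_dotR_neg {d : ℕ} {m n : Rd d} (hm : m ≠ 0) (hn : n ≠ 0)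
    (hmn : ‖m‖⁻¹ • m + ‖n‖⁻¹ • n ≠ 0) : ∃ a : Rd d, dotR d a m < 0 ∧ dotR d a n < 0 := by
  have hA : 0 < dotR d m m := (dotR_self_nonneg d m).lt_of_ne' (dotR_self_eq_zero.not.2 hm)
  have hB : 0 < dotR d n n := (dotR_self_nonneg d n).lt_of_ne' (dotR_self_eq_zero.not.2 hn)
  obtain ⟨s, hs, hsA⟩ : ∃ s : ℝ, 0 < s ∧ s * s = dotR d m m :=
    ⟨_, Real.sqrt_pos.2 hA, Real.mul_self_sqrt hA.le⟩
  obtain ⟨r, hr, hrB⟩ : ∃ r : ℝ, 0 < r ∧ r * r = dotR d n n :=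
    ⟨_, Real.sqrt_pos.2 hB, Real.mul_self_sqrt hB.le⟩
  have hw : r • m + s • n ≠ 0 := by
    intro hw
    have hm' : m = -((r⁻¹ * s) • n) := by
      rw [mul_smul, ← smul_neg, ← eq_neg_of_add_eq_zero_left hw, smul_smul,
        inv_mul_cancel₀ hr.ne', one_smul]
    refine hmn ?_
    have hc : 0 < r⁻¹ * s := mul_pos (inv_pos.2 hr) hs
    generalize r⁻¹ * s = c at hm' hc
    rw [hm', norm_neg, norm_smul, Real.norm_of_nonneg hc.le, smul_neg, smul_smul, mul_inv,
      mul_right_comm, inv_mul_cancel₀ hc.ne', one_mul, neg_add_cancel]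
  have hpos : 0 < dotR d (r • m + s • n) (r • m + s • n) :=
    (dotR_self_nonneg d _).lt_of_ne' (dotR_self_eq_zero.not.2 hw)
  rw [dotR_smul_add_smul, dotR_comm d m, dotR_comm d n, dotR_smul_add_smul,
    dotR_smul_add_smul, dotR_comm d n m, ← hsA, ← hrB] at hpos
  have hC : 0 < r * s + dotR d m n := by
    have hrs : 0 < 2 * (r * s) := by positivity
    refine pos_of_mul_pos_right (a := 2 * (r * s)) ?_ hrs.le
    linarith
  refine ⟨(-r) • m + (-s) • n, ?_, ?_⟩
  · rw [dotR_smul_add_smul, dotR_comm d n m, ← hsA]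
    linarith [mul_pos hs hC]
  · rw [dotR_smul_add_smul, ← hrB]
    linarith [mul_pos hr hC]

/-- under (H0)-(H4) the reflected random walk is transient, i.e. its
Green's function is finite everywhere. -/
theorem transience
    (d : ℕ) (hd : 2 ≤ d) (μ μ0 : Zd d → ℝ)
    (hμ : IsProb d μ) (hμ0 : IsProb d μ0)
    (hH0 : H0 d μ μ0) (hH1 : H1 d μ μ0) (hH2 : H2 d μ)
    (hH3 : H3 d μ μ0) (hH4 : H4 d μ μ0) :
    ∀ z z' : St d, green d μ μ0 z z' < ⊤ := by
  obtain ⟨a, ha, ha0⟩ := exists_dotR_neg hH3.1 hH3.2.1 hH3.2.2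
  obtain ⟨t, ht, ht0⟩ := ((eventually_jgf_smul_lt_one hμ (fun b => (hH4 b).1) ha).and
    (eventually_jgf_smul_lt_one hμ0 (fun b => (hH4 b).2) ha0)).exists
  refine tsum_kerIter_lt_top
    (θ := max (ENNReal.ofReal (jgf d μ (t • a))) (ENNReal.ofReal (jgf d μ0 (t • a))))
    (h := fun z => ENNReal.ofReal (Real.exp (dotZ d (t • a) (toZ d z)))) (fun z => ?_)
    (max_lt (ENNReal.ofReal_lt_one.2 ht) (ENNReal.ofReal_lt_one.2 ht0))
    (fun z => (ENNReal.ofReal_pos.2 (Real.exp_pos _)).ne') (fun z => ENNReal.ofReal_ne_top)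
  by_cases hz : z.2 = 0
  · simp only [step, if_pos hz]
    exact (tsum_ofReal_mul_exp_le hμ0.1 (hH4 _).2 z).trans (by gcongr; exact le_max_right _ _)
  · simp only [step, if_neg hz]
    exact (tsum_ofReal_mul_exp_le hμ.1 (hH4 _).1 z).trans (by gcongr; exact le_max_left _ _)

end ReflectedRW
end

section
/- Under hypotheses (H0)-(H4), the set Θ := {α ∈ ℝ^{d−1} : inf_{β∈ℝ} max(φ(α,β), φ₀(α,β)) ≤ 1} is strictly convex: for any two distinct points α, α' ∈ Θ and any 0 < θ < 1, the point θα + (1−θ)α' belongs to the interior of Θ. -/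
open scoped ENNReal
open Filter MeasureTheory

namespace ReflectedRW

/-- A property preserved by every transition of positive weight holds along the iterates. -/
theorem kerIter_invariant {S : Type*} [DecidableEq S] {p : S → S → ℝ≥0∞} {P : S → Prop}
    (hP : ∀ w z, P w → p w z ≠ 0 → P z) (n : ℕ) {z z' : S} (hz : P z)
    (h : kerIter p n z z' ≠ 0) : P z' := by
  induction n generalizing z' with
  | zero =>
    by_cases hzz : z = z'
    · exact hzz ▸ hz
    · simp [kerIter, hzz] at h
  | succ n ih =>
    obtain ⟨w, hw⟩ : ∃ w, kerIter p n z w * p w z' ≠ 0 := by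
      by_contra! hcon
      exact h (by simp [kerIter, hcon])
    exact hP w z' (ih (left_ne_zero_of_mul hw)) (right_ne_zero_of_mul hw)

section Exponent

variable {d : ℕ}

theorem dotZ_comb (s t : ℝ) (a b : Rd d) (z : Zd d) :
    dotZ d (s • a + t • b) z = s * dotZ d a z + t * dotZ d b z := by
  simp only [dotZ, Prod.fst_add, Prod.snd_add, Prod.smul_fst, Prod.smul_snd, Pi.add_apply,
    Pi.smul_apply, smul_eq_mul, mul_add, Finset.mul_sum, add_mul, Finset.sum_add_distrib, mul_assoc]
  ring

theorem dotZ_add_right (a : Rd d) (z w : Zd d) :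
    dotZ d a (z + w) = dotZ d a z + dotZ d a w := by
  simp only [dotZ, Prod.fst_add, Prod.snd_add, Pi.add_apply, Int.cast_add, mul_add,
    Finset.sum_add_distrib]
  ring

theorem dotZ_sub_left (a b : Rd d) (z : Zd d) :
    dotZ d (a - b) z = dotZ d a z - dotZ d b z := by
  simp only [dotZ, Prod.fst_sub, Prod.snd_sub, Pi.sub_apply, sub_mul, Finset.sum_sub_distrib]
  ring

theorem dotZ_mk (α : Fin (d - 1) → ℝ) (β : ℝ) (z : Zd d) :
    dotZ d (α, β) z = dotZ d (α, 0) z + β * z.2 := by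
  simp [dotZ]

theorem eq_zero_of_dotZ_eq_zero {v : Rd d} (h : ∀ z, dotZ d v z = 0) : v = 0 := by
  refine Prod.ext (funext fun i => ?_) ?_
  · simpa [dotZ, Pi.single_apply] using h (Pi.single i 1, 0)
  · simpa [dotZ] using h (0, 1)

end Exponent

section GeneratingFunction

variable {d : ℕ} {ν : Zd d → ℝ}

theorem exp_comb_le {s t x y : ℝ} (hs : 0 ≤ s) (ht : 0 ≤ t) (hst : s + t = 1) :
    Real.exp (s * x + t * y) ≤ s * Real.exp x + t * Real.exp y :=
  convexOn_exp.2 (Set.mem_univ x) (Set.mem_univ y) hs ht hst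

theorem jgf_comb (hs : ∀ a, Summable fun z => ν z * Real.exp (dotZ d a z))
    (s t : ℝ) (a b : Rd d) :
    HasSum (fun z => ν z * (s * Real.exp (dotZ d a z) + t * Real.exp (dotZ d b z)))
      (s * jgf d ν a + t * jgf d ν b) := by
  have hfun : (fun z => ν z * (s * Real.exp (dotZ d a z) + t * Real.exp (dotZ d b z))) =
      fun z => s * (ν z * Real.exp (dotZ d a z)) + t * (ν z * Real.exp (dotZ d b z)) :=
    funext fun z => by ring
  exact hfun ▸ ((hs a).hasSum.mul_left s).add ((hs b).hasSum.mul_left t)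

theorem jgf_comb_le (hν : ∀ z, 0 ≤ ν z)
    (hs : ∀ a, Summable fun z => ν z * Real.exp (dotZ d a z))
    {s t : ℝ} (h0 : 0 ≤ s) (h1 : 0 ≤ t) (hst : s + t = 1) (a b : Rd d) :
    jgf d ν (s • a + t • b) ≤ s * jgf d ν a + t * jgf d ν b := by
  refine hasSum_le (fun z => ?_) (hs _).hasSum (jgf_comb hs s t a b)
  rw [dotZ_comb]
  exact mul_le_mul_of_nonneg_left (exp_comb_le h0 h1 hst) (hν z)

theorem jgf_comb_lt (hν : ∀ z, 0 ≤ ν z)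
    (hs : ∀ a, Summable fun z => ν z * Real.exp (dotZ d a z))
    {s t : ℝ} (h0 : 0 < s) (h1 : 0 < t) (hst : s + t = 1) {a b : Rd d}
    (hab : ∃ z, 0 < ν z ∧ dotZ d a z ≠ dotZ d b z) :
    jgf d ν (s • a + t • b) < s * jgf d ν a + t * jgf d ν b := by
  obtain ⟨z₀, hz₀, hne⟩ := hab
  refine hasSum_lt (i := z₀) (fun z => ?_) ?_ (hs _).hasSum (jgf_comb hs s t a b)
  · rw [dotZ_comb]
    exact mul_le_mul_of_nonneg_left (exp_comb_le h0.le h1.le hst) (hν z)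
  · rw [dotZ_comb]
    exact mul_lt_mul_of_pos_left
      (strictConvexOn_exp.2 (Set.mem_univ _) (Set.mem_univ _) hne h0 h1 hst) hz₀

theorem continuous_jgf (hν : ∀ z, 0 ≤ ν z)
    (hs : ∀ a, Summable fun z => ν z * Real.exp (dotZ d a z)) : Continuous (jgf d ν) := by
  have hconv : ConvexOn ℝ Set.univ (jgf d ν) :=
    ⟨convex_univ, fun a _ b _ s t h0 h1 hst => jgf_comb_le hν hs h0 h1 hst a b⟩
  simpa using hconv.continuousOn_interior

theorem term_le_jgf (hν : ∀ z, 0 ≤ ν z)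
    (hs : ∀ a, Summable fun z => ν z * Real.exp (dotZ d a z)) (a : Rd d) (z : Zd d) :
    ν z * Real.exp (dotZ d a z) ≤ jgf d ν a :=
  (hs a).le_tsum z fun w _ => mul_nonneg (hν w) (Real.exp_pos _).le

/-- A generating function supported on upward jumps, at least one of them strictly upward,
is strictly increasing in the last coordinate. -/
theorem jgf_strictMono_snd (hν : ∀ z, 0 ≤ ν z)
    (hs : ∀ a, Summable fun z => ν z * Real.exp (dotZ d a z))
    (hneg : ∀ z : Zd d, z.2 < 0 → ν z = 0) (hpos : ∃ z : Zd d, 0 < ν z ∧ 0 < z.2)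
    (α : Fin (d - 1) → ℝ) : StrictMono fun β => jgf d ν (α, β) := by
  intro β β' hβ
  obtain ⟨z₀, hz₀, hy₀⟩ := hpos
  refine hasSum_lt (i := z₀) (fun z => ?_) ?_ (hs (α, β)).hasSum (hs (α, β')).hasSum
  · rcases lt_or_ge z.2 0 with hz | hz
    · simp [hneg z hz]
    · have : (0 : ℝ) ≤ z.2 := by exact_mod_cast hz
      refine mul_le_mul_of_nonneg_left (Real.exp_le_exp.2 ?_) (hν z)
      rw [dotZ_mk α β, dotZ_mk α β']
      gcongr
  · have : (0 : ℝ) < z₀.2 := by exact_mod_cast hy₀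
    refine mul_lt_mul_of_pos_left (Real.exp_lt_exp.2 ?_) hz₀
    rw [dotZ_mk α β, dotZ_mk α β']
    gcongr

/-- With both upward and downward jumps, the generating function is coercive in the last
coordinate. -/
theorem tendsto_jgf_snd (hν : ∀ z, 0 ≤ ν z)
    (hs : ∀ a, Summable fun z => ν z * Real.exp (dotZ d a z))
    (hpos : ∃ z : Zd d, 0 < ν z ∧ 0 < z.2) (hneg : ∃ z : Zd d, 0 < ν z ∧ z.2 < 0)
    (α : Fin (d - 1) → ℝ) : Tendsto (fun β => jgf d ν (α, β)) (cocompact ℝ) atTop := by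
  have key : ∀ (l : Filter ℝ) (z : Zd d), 0 < ν z → Tendsto (fun β : ℝ => β * z.2) l atTop →
      Tendsto (fun β => jgf d ν (α, β)) l atTop := fun l z hz hl => by
    refine tendsto_atTop_mono (fun β => term_le_jgf hν hs (α, β) z) ?_
    refine ((Real.tendsto_exp_atTop.comp
      (tendsto_atTop_add_const_left _ (dotZ d (α, 0) z) hl)).const_mul_atTop hz).congr fun β => ?_
    rw [dotZ_mk α β, Function.comp_apply]
  rw [cocompact_eq_atBot_atTop]
  refine Tendsto.sup ?_ ?_
  · obtain ⟨z, hz, hy⟩ := hneg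
    exact key _ z hz (tendsto_id.atBot_mul_const_of_neg (by exact_mod_cast hy))
  · obtain ⟨z, hz, hy⟩ := hpos
    exact key _ z hz (tendsto_id.atTop_mul_const (by exact_mod_cast hy))

end GeneratingFunction

section Irreducibility

variable {d : ℕ} {μ μ0 : Zd d → ℝ}

/-- A property of `ℤ^d` that holds at one point, and is preserved by all jumps of positive
probability of an irreducible walk, holds everywhere. -/
theorem forall_of_jump_invariant (hirr : ∀ z z' : Zd d, ∃ n : ℕ, 0 < stepSn d μ n z z')
    {P : Zd d → Prop} (h0 : P 0) (hP : ∀ w z, P w → 0 < μ z → P (w + z)) (z : Zd d) : P z := by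
  obtain ⟨n, hn⟩ := hirr 0 z
  refine kerIter_invariant (fun w z' hw hz' => ?_) n h0 hn.ne'
  simpa using hP w (z' - w) hw (ENNReal.ofReal_pos.1 (pos_iff_ne_zero.2 hz'))

theorem exists_dotZ_ne_zero (hirr : ∀ z z' : Zd d, ∃ n : ℕ, 0 < stepSn d μ n z z')
    {v : Rd d} (hv : v ≠ 0) : ∃ z, 0 < μ z ∧ dotZ d v z ≠ 0 := by
  by_contra! hcon
  refine hv (eq_zero_of_dotZ_eq_zero (forall_of_jump_invariant hirr ?_ fun w z hw hz => ?_))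
  · simp [dotZ]
  · rw [dotZ_add_right, hw, hcon z hz, add_zero]

theorem exists_up_jump (hirr : ∀ z z' : Zd d, ∃ n : ℕ, 0 < stepSn d μ n z z') :
    ∃ z : Zd d, 0 < μ z ∧ 0 < z.2 := by
  by_contra! hcon
  have := forall_of_jump_invariant hirr (P := fun z => z.2 ≤ 0) le_rfl
    (fun w z hw hz => add_nonpos hw (hcon z hz)) (0, 1)
  norm_num at this

theorem exists_down_jump (hirr : ∀ z z' : Zd d, ∃ n : ℕ, 0 < stepSn d μ n z z') :
    ∃ z : Zd d, 0 < μ z ∧ z.2 < 0 := by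
  by_contra! hcon
  have := forall_of_jump_invariant hirr (P := fun z => 0 ≤ z.2) le_rfl
    (fun w z hw hz => add_nonneg hw (hcon z hz)) (0, -1)
  norm_num at this

theorem exists_boundary_up_jump (hH1 : H1 d μ μ0) : ∃ z : Zd d, 0 < μ0 z ∧ 0 < z.2 := by
  by_contra! hcon
  obtain ⟨n, hn⟩ := hH1 (0, 0) (0, 1)
  have : ((0, 1) : St d).2 = 0 := by
    refine kerIter_invariant (P := fun z : St d => z.2 = 0) (fun w z hw hz => ?_) n rfl hn.ne'
    rw [step, if_pos hw] at hz
    have := hcon _ (ENNReal.ofReal_pos.1 (pos_iff_ne_zero.2 hz))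
    simp only [toZ, Prod.snd_sub, hw] at this
    omega
  exact one_ne_zero this

end Irreducibility

/-- The infimum over `β` in the definition of `Θ` is attained. -/
theorem mem_Theta_iff {d : ℕ} {μ μ0 : Zd d → ℝ} (hμ : ∀ z, 0 ≤ μ z) (hμ0 : ∀ z, 0 ≤ μ0 z)
    (hirr : ∀ z z' : Zd d, ∃ n : ℕ, 0 < stepSn d μ n z z') (hH4 : H4 d μ μ0)
    {α : Fin (d - 1) → ℝ} :
    α ∈ Theta d μ μ0 ↔ ∃ β : ℝ, jgf d μ (α, β) ≤ 1 ∧ jgf d μ0 (α, β) ≤ 1 := by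
  have hs := fun a => (hH4 a).1
  have hs0 := fun a => (hH4 a).2
  have hcont : Continuous fun β : ℝ => max (jgf d μ (α, β)) (jgf d μ0 (α, β)) :=
    ((continuous_jgf hμ hs).comp (by fun_prop)).max ((continuous_jgf hμ0 hs0).comp (by fun_prop))
  obtain ⟨β₀, hβ₀⟩ := hcont.exists_forall_le (tendsto_atTop_mono (fun β => le_max_left _ _)
    (tendsto_jgf_snd hμ hs (exists_up_jump hirr) (exists_down_jump hirr) α))
  have hbdd : BddBelow (Set.range fun β : ℝ => max (jgf d μ (α, β)) (jgf d μ0 (α, β))) :=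
    ⟨_, Set.forall_mem_range.2 hβ₀⟩
  exact ⟨fun h => ⟨β₀, max_le_iff.1 ((le_ciInf hβ₀).trans h)⟩,
    fun ⟨β, hβ⟩ => (ciInf_le hbdd β).trans (max_le_iff.2 hβ)⟩

/-- the set `Θ` is strictly convex. -/
theorem theta_strictly_convex
    (d : ℕ) (hd : 2 ≤ d) (μ μ0 : Zd d → ℝ)
    (hμ : IsProb d μ) (hμ0 : IsProb d μ0)
    (hH0 : H0 d μ μ0) (hH1 : H1 d μ μ0) (hH2 : H2 d μ)
    (hH3 : H3 d μ μ0) (hH4 : H4 d μ μ0) :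
    ∀ α α' : Fin (d-1) → ℝ, α ∈ Theta d μ μ0 → α' ∈ Theta d μ μ0 → α ≠ α' →
      ∀ θ : ℝ, 0 < θ → θ < 1 →
        θ • α + (1 - θ) • α' ∈ interior (Theta d μ μ0) := by
  intro α α' hα hα' hne θ hθ0 hθ1
  have hirr := hH2.1
  have hs := fun a => (hH4 a).1
  have hs0 := fun a => (hH4 a).2
  have hiff := fun α => mem_Theta_iff (α := α) hμ.1 hμ0.1 hirr hH4
  obtain ⟨β, hβ, hβ0⟩ := (hiff α).1 hα
  obtain ⟨β', hβ', hβ0'⟩ := (hiff α').1 hα'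
  have hθ' : 0 < 1 - θ := sub_pos.2 hθ1
  have hsum : θ + (1 - θ) = 1 := by ring
  set γ := θ • α + (1 - θ) • α' with hγ
  set δ := θ * β + (1 - θ) * β' with hδ
  have hcomb : θ • ((α, β) : Rd d) + (1 - θ) • ((α', β') : Rd d) = (γ, δ) := rfl
  have hlt : jgf d μ (γ, δ) < 1 := by
    have hsub : ((α, β) : Rd d) - (α', β') ≠ 0 := fun h =>
      hne (sub_eq_zero.1 (congrArg Prod.fst h))
    obtain ⟨z, hz, hvz⟩ := exists_dotZ_ne_zero hirr hsub
    rw [dotZ_sub_left, sub_ne_zero] at hvz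
    have := jgf_comb_lt hμ.1 hs hθ0 hθ' hsum ⟨z, hz, hvz⟩
    rw [hcomb] at this
    nlinarith
  have hle : jgf d μ0 (γ, δ) ≤ 1 := by
    have := jgf_comb_le hμ0.1 hs0 hθ0.le hθ'.le hsum (α, β) (α', β')
    rw [hcomb] at this
    nlinarith
  have hc := continuous_jgf hμ.1 hs
  have hc0 := continuous_jgf hμ0.1 hs0
  obtain ⟨ε, hε, hεδ⟩ : ∃ ε, jgf d μ (γ, ε) < 1 ∧ ε < δ := by
    have hev : ∀ᶠ ε in nhds δ, jgf d μ (γ, ε) < 1 :=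
      (hc.comp (Continuous.prodMk_right γ)).continuousAt.eventually_lt_const hlt
    exact ((hev.filter_mono nhdsWithin_le_nhds).and
      (eventually_mem_nhdsWithin (s := Set.Iio δ))).exists
  have hε0 : jgf d μ0 (γ, ε) < 1 :=
    (jgf_strictMono_snd hμ0.1 hs0 hH0.2 (exists_boundary_up_jump hH1) γ hεδ).trans_le hle
  rw [mem_interior_iff_mem_nhds]
  have hcε : Continuous fun a : Fin (d - 1) → ℝ => ((a, ε) : Rd d) := Continuous.prodMk_left ε
  filter_upwards [(hc.comp hcε).continuousAt.eventually_lt_const hε,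
    (hc0.comp hcε).continuousAt.eventually_lt_const hε0] with a ha ha0
  exact (hiff a).2 ⟨ε, ha.le, ha0.le⟩

end ReflectedRW
end
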